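/- Let f be holomorphic on the rectangle P = (−a, a) × (−b, b), with |f(x+iy)| ≤ M(y) where M : (−b,b) → [1,∞) is measurable, and set F(t) = λ₁({y ∈ (−b,b) : log⁺ M(y) ≥ t}). If K ⊂ P is compact, C > 0 is such that d(K, ∂P) > (8/π) ∑_{i=−1}^{∞} F(2^i C), then |f| ≤ exp(C) on K. -/

import Mathlib

open MeasureTheory

/-- `log⁺ x = max (log x) 0`. -/
noncomputable def logPlus (x : ℝ) : ℝ := max (Real.log x) 0

/-- The open rectangle `(-a,a) × (-b,b)` viewed as a subset of `ℂ`. -/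
def Rect (a b : ℝ) : Set ℂ := {z | |z.re| < a ∧ |z.im| < b}

lemma log_le_circleAverage {f : ℂ → ℂ} {c : ℂ} {R : ℝ} (hR : 0 < R)
    (hf : AnalyticOnNhd ℂ f (Metric.closedBall c R)) (h0 : f c ≠ 0) :
    Real.log ‖f c‖ ≤ Real.circleAverage (Real.log ‖f ·‖) c R := by
  have hf' : AnalyticOnNhd ℂ f (Metric.closedBall c |R|) := by rwa [abs_of_pos hR]
  rw [hf'.circleAverage_log_norm hR.ne' h0]
  have : 0 ≤ ∑ᶠ u, (MeromorphicOn.divisor f (Metric.closedBall c |R|) u : ℝ)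
      * Real.log (R * ‖c - u‖⁻¹) := by
    apply finsum_nonneg
    intro u
    by_cases hu : u ∈ Metric.closedBall c |R|
    · apply mul_nonneg
      · have := MeromorphicOn.AnalyticOnNhd.divisor_nonneg hf' u
        exact_mod_cast this
      · by_cases huc : c = u
        · simp [huc]
        · have h1 : 0 < ‖c - u‖ := norm_pos_iff.2 (sub_ne_zero.2 huc)
          apply Real.log_nonneg
          rw [← div_eq_mul_inv, le_div_iff₀ h1]
          rw [abs_of_pos hR, Metric.mem_closedBall, dist_comm, dist_eq_norm] at hu
          linarith
    · simp [hu]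
  linarith

lemma circle_measure {f : ℂ → ℂ} {z : ℂ} {r c : ℝ} (hr : 0 < r) (hc : 0 < c)
    {E : Set ℝ} (hE : MeasurableSet E)
    (hf : AnalyticOnNhd ℂ f (Metric.closedBall z r))
    (hz : c ≤ Real.log ‖f z‖)
    (h1 : ∀ w ∈ Metric.closedBall z r, w.im ∉ E → Real.log ‖f w‖ ≤ c / 2)
    (h2 : ∀ w ∈ Metric.closedBall z r, Real.log ‖f w‖ ≤ 2 * c) :
    ENNReal.ofReal (2 * Real.pi / 3) ≤
      volume ({θ : ℝ | (circleMap z r θ).im ∈ E} ∩ Set.Ioo (-Real.pi) Real.pi) := by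
  have h0 : f z ≠ 0 := by
    intro h; rw [h] at hz; simp at hz; linarith
  have hS : MeasurableSet {θ : ℝ | (circleMap z r θ).im ∈ E} := by
    have : Measurable fun θ : ℝ => (circleMap z r θ).im :=
      (Complex.continuous_im.comp (continuous_circleMap z r)).measurable
    exact this hE
  set S := {θ : ℝ | (circleMap z r θ).im ∈ E} with hSdef
  have hJ := log_le_circleAverage hr hf h0
  have hint : CircleIntegrable (Real.log ‖f ·‖) z r := by
    apply MeromorphicOn.circleIntegrable_log_norm
    rw [abs_of_pos hr]
    exact (hf.mono Metric.sphere_subset_closedBall).meromorphicOn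
  have hper : ∫ θ in (0:ℝ)..2 * Real.pi, Real.log ‖f (circleMap z r θ)‖ =
      ∫ θ in (-Real.pi)..Real.pi, Real.log ‖f (circleMap z r θ)‖ := by
    have hp : Function.Periodic (fun θ => Real.log ‖f (circleMap z r θ)‖) (2 * Real.pi) := by
      intro θ; simp [periodic_circleMap z r θ]
    have := hp.intervalIntegral_add_eq 0 (-Real.pi)
    rw [zero_add] at this
    rw [this]; congr 1; ring
  have hint2 : IntervalIntegrable (fun θ => Real.log ‖f (circleMap z r θ)‖) volume
      (-Real.pi) Real.pi := by
    have hp : Function.Periodic (fun θ => Real.log ‖f (circleMap z r θ)‖) (2 * Real.pi) := by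
      intro θ; simp [periodic_circleMap z r θ]
    exact hp.intervalIntegrable₀ (by positivity) hint _ _
  rw [Real.circleAverage_def, hper, intervalIntegral.integral_of_le (by linarith [Real.pi_pos]),
    integral_Ioc_eq_integral_Ioo] at hJ
  have hint3 : IntegrableOn (fun θ => Real.log ‖f (circleMap z r θ)‖)
      (Set.Ioo (-Real.pi) Real.pi) := by
    rw [← intervalIntegrable_iff_integrableOn_Ioo_of_le (by linarith [Real.pi_pos])]
    exact hint2
  have hindi : IntegrableOn (S.indicator fun _ => (3 * c / 2)) (Set.Ioo (-Real.pi) Real.pi) :=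
    Integrable.indicator (integrableOn_const (by simp)) hS
  have hmono : ∫ θ in Set.Ioo (-Real.pi) Real.pi, Real.log ‖f (circleMap z r θ)‖ ≤
      ∫ θ in Set.Ioo (-Real.pi) Real.pi, (c / 2 + S.indicator (fun _ => (3 * c / 2)) θ) := by
    apply setIntegral_mono_on hint3 _ measurableSet_Ioo
    · intro θ _
      have hm := circleMap_mem_closedBall z hr.le θ
      by_cases hθ : θ ∈ S
      · rw [Set.indicator_of_mem hθ]
        linarith [h2 _ hm]
      · rw [Set.indicator_of_notMem hθ]
        linarith [h1 _ hm hθ]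
    · exact Integrable.add (integrableOn_const (by simp)) hindi
  have hconst : IntegrableOn (fun _ : ℝ => c / 2) (Set.Ioo (-Real.pi) Real.pi) :=
    integrableOn_const (by simp)
  rw [integral_add hconst hindi, integral_indicator hS,
    Measure.restrict_restrict hS, setIntegral_const, setIntegral_const] at hmono
  rw [ENNReal.ofReal_le_iff_le_toReal
    ((measure_mono Set.inter_subset_right).trans_lt (by simp)).ne]
  change _ ≤ volume.real _
  set m := volume.real (S ∩ Set.Ioo (-Real.pi) Real.pi)
  set I := ∫ θ in Set.Ioo (-Real.pi) Real.pi, Real.log ‖f (circleMap z r θ)‖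
  have hpi := Real.pi_pos
  have : volume.real (Set.Ioo (-Real.pi) Real.pi) = 2 * Real.pi := by
    rw [Real.volume_real_Ioo_of_le (by linarith)]; ring
  rw [this] at hmono
  simp only [smul_eq_mul] at hJ hmono
  have h5 : 2 * Real.pi * c ≤ I := by
    have := hz.trans hJ
    rw [inv_mul_eq_div, le_div_iff₀ (by positivity)] at this
    linarith
  have h6 : Real.pi * c ≤ m * (3 * c / 2) := by nlinarith
  have h7 : Real.pi * c ≤ (m * 3 / 2) * c := by linarith
  have := le_of_mul_le_mul_right h7 hc
  linarith

lemma volume_strip (z : ℂ) {R : ℝ} {E : Set ℝ} :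
    volume {w : ℂ | ‖w‖ < R ∧ (z + w).im ∈ E} ≤ ENNReal.ofReal (2 * R) * volume E := by
  have hsub : {w : ℂ | ‖w‖ < R ∧ (z + w).im ∈ E} ⊆
      Complex.measurableEquivRealProd ⁻¹' (Set.Ioo (-R) R ×ˢ ((fun y => z.im + y) ⁻¹' E)) := by
    rintro w ⟨h1, h2⟩
    simp only [Set.mem_preimage, Complex.measurableEquivRealProd_apply, Set.mem_prod, Set.mem_Ioo]
    exact ⟨abs_lt.1 ((Complex.abs_re_le_norm w).trans_lt h1), by simpa using h2⟩
  refine (measure_mono hsub).trans ?_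
  rw [Complex.volume_preserving_equiv_real_prod.measure_preimage_equiv, Measure.volume_eq_prod,
    Measure.prod_prod, measure_preimage_add, Real.volume_Ioo]
  apply le_of_eq; congr 2; ring

lemma step {f : ℂ → ℂ} {z : ℂ} {R c : ℝ} (hR : 0 < R) (hc : 0 < c)
    {E : Set ℝ} (hE : MeasurableSet E)
    (hf : AnalyticOnNhd ℂ f (Metric.closedBall z R))
    (hz : c ≤ Real.log ‖f z‖)
    (h1 : ∀ w ∈ Metric.closedBall z R, w.im ∉ E → Real.log ‖f w‖ ≤ c / 2)
    (hvol : volume E ≤ ENNReal.ofReal (Real.pi * R / 8)) :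
    ∃ w ∈ Metric.closedBall z R, 2 * c ≤ Real.log ‖f w‖ := by
  by_contra! h2
  have hpi := Real.pi_pos
  set A : Set ℂ := {w : ℂ | ‖w‖ < R ∧ (z + w).im ∈ E} with hA
  have hAm : MeasurableSet A := by
    apply MeasurableSet.inter
    · exact measurableSet_lt measurable_norm measurable_const
    · exact (Complex.measurable_im.comp (measurable_const.add measurable_id)) hE
  have hup : volume A ≤ ENNReal.ofReal (Real.pi * R ^ 2 / 4) := by
    refine (volume_strip z).trans ?_
    refine (mul_le_mul_right hvol _).trans ?_
    rw [← ENNReal.ofReal_mul (by positivity)]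
    apply le_of_eq; congr 1; ring
  have hlow : ENNReal.ofReal (Real.pi * R ^ 2 / 3) ≤ volume A := by
    rw [← lintegral_indicator_one hAm, ← Complex.lintegral_comp_polarCoord_symm]
    change _ ≤ ∫⁻ p in Set.Ioi (0 : ℝ) ×ˢ Set.Ioo (-Real.pi) Real.pi, _
    have hmeas : Measurable (fun p : ℝ × ℝ => ENNReal.ofReal p.1 •
        A.indicator (1 : ℂ → ENNReal) (Complex.polarCoord.symm p)) := by
      apply Measurable.mul
      · fun_prop
      · apply (measurable_one.indicator hAm).comp
        have : (fun p => Complex.polarCoord.symm p : ℝ × ℝ → ℂ) = fun p : ℝ × ℝ =>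
            (p.1 : ℂ) * ((Real.cos p.2 : ℂ) + (Real.sin p.2 : ℂ) * Complex.I) := by
          funext p; exact Complex.polarCoord_symm_apply p
        change Measurable (fun p => Complex.polarCoord.symm p : ℝ × ℝ → ℂ)
        rw [this]
        fun_prop
    rw [Measure.volume_eq_prod, ← Measure.prod_restrict, lintegral_prod _ hmeas.aemeasurable]
    calc ENNReal.ofReal (Real.pi * R ^ 2 / 3)
        = ∫⁻ r in Set.Ioo 0 R, ENNReal.ofReal r * ENNReal.ofReal (2 * Real.pi / 3) := by
          rw [lintegral_mul_const _ (by fun_prop),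
            ← ofReal_integral_eq_lintegral_ofReal, ← integral_Ioc_eq_integral_Ioo,
            ← intervalIntegral.integral_of_le hR.le, integral_id,
            ← ENNReal.ofReal_mul (by nlinarith)]
          · congr 1; ring
          · exact (continuous_id.integrableOn_Icc (a := 0) (b := R)).mono_set
              Set.Ioo_subset_Icc_self
          · filter_upwards [self_mem_ae_restrict measurableSet_Ioo] with x hx using hx.1.le
      _ ≤ ∫⁻ r in Set.Ioo 0 R, ∫⁻ θ in Set.Ioo (-Real.pi) Real.pi, ENNReal.ofReal r •
            A.indicator (1 : ℂ → ENNReal) (Complex.polarCoord.symm (r, θ)) := by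
          apply setLIntegral_mono' measurableSet_Ioo
          intro r hr
          simp only [smul_eq_mul]
          rw [lintegral_const_mul']
          swap
          · simp
          gcongr
          have hsub := Metric.closedBall_subset_closedBall (x := z) hr.2.le
          refine (circle_measure hr.1 hc hE (hf.mono hsub) hz
            (fun w hw => h1 w (hsub hw)) (fun w hw => (h2 w (hsub hw)).le)).trans ?_
          have hS : MeasurableSet {θ : ℝ | (circleMap z r θ).im ∈ E} := by
            have : Measurable fun θ : ℝ => (circleMap z r θ).im :=
              (Complex.continuous_im.comp (continuous_circleMap z r)).measurable
            exact this hE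
          rw [← Measure.restrict_apply hS, ← lintegral_indicator_one hS]
          apply lintegral_mono
          intro θ
          have hz' : circleMap z r θ = z + Complex.polarCoord.symm (r, θ) := by
            rw [Complex.polarCoord_symm_apply, circleMap, Complex.exp_mul_I]
            simp
          apply le_of_eq
          beta_reduce
          by_cases hθ : (circleMap z r θ).im ∈ E
          · rw [Set.indicator_of_mem (s := {θ : ℝ | (circleMap z r θ).im ∈ E}) hθ,
              Set.indicator_of_mem]
            · rfl
            · refine ⟨?_, hz' ▸ hθ⟩
              rw [Complex.norm_polarCoord_symm]
              simpa [abs_of_pos hr.1] using hr.2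
          · rw [Set.indicator_of_notMem (s := {θ : ℝ | (circleMap z r θ).im ∈ E}) hθ,
              Set.indicator_of_notMem]
            intro h
            exact hθ (hz' ▸ h.2)
      _ ≤ _ := lintegral_mono_set (fun x hx => hx.1)
  have := hlow.trans hup
  rw [ENNReal.ofReal_le_ofReal_iff (by positivity)] at this
  have : 0 < Real.pi * R ^ 2 := by positivity
  linarith

/-- Explicit quantitative form of Domar's bound: if `f` is holomorphic on the rectangle
`P` with `|f(x+iy)| ≤ M(y)`, `F(t) = λ₁{y ∈ (-b,b) : log⁺ M(y) ≥ t}`, `K ⊆ P` is compact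
and `C > 0` satisfies `d(K, ∂P) > (8/π) ∑_{i=-1}^{∞} F(2^i C)`, then `|f| ≤ exp C` on `K`. -/
theorem stmt17 (a b : ℝ) (ha : 0 < a) (hb : 0 < b)
    (M : ℝ → ℝ) (hMmeas : Measurable M) (hM1 : ∀ y ∈ Set.Ioo (-b) b, 1 ≤ M y)
    (f : ℂ → ℂ) (hf : DifferentiableOn ℂ f (Rect a b))
    (hbd : ∀ z ∈ Rect a b, ‖f z‖ ≤ M z.im)
    (F : ℝ → ENNReal)
    (hF : ∀ t, F t = volume {y | y ∈ Set.Ioo (-b) b ∧ t ≤ logPlus (M y)})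
    (K : Set ℂ) (hK : IsCompact K) (hKP : K ⊆ Rect a b)
    (C : ℝ) (hC : 0 < C)
    (hd : ∀ z ∈ K,
      ENNReal.ofReal (8 / Real.pi) * ∑' i : ℕ, F ((2 : ℝ) ^ ((i : ℤ) - 1) * C) <
        ENNReal.ofReal (Metric.infDist z (Rect a b)ᶜ)) :
    ∀ z ∈ K, ‖f z‖ ≤ Real.exp C := by
  intro z₀ hz₀
  by_contra! hlt
  have hpi := Real.pi_pos
  have hopen : IsOpen (Rect a b) := by
    exact (isOpen_lt (f := fun z : ℂ => |z.re|) (g := fun _ => a) (by fun_prop)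
      (by fun_prop)).inter (isOpen_lt (f := fun z : ℂ => |z.im|) (g := fun _ => b)
      (by fun_prop) (by fun_prop))
  have hlog0 : C ≤ Real.log ‖f z₀‖ := by
    rw [Real.le_log_iff_exp_le ((Real.exp_pos C).trans hlt)]
    exact hlt.le
  set E : ℕ → Set ℝ := fun i =>
    {y | y ∈ Set.Ioo (-b) b ∧ (2 : ℝ) ^ ((i : ℤ) - 1) * C ≤ logPlus (M y)}
    with hEdef
  have hE : ∀ i, MeasurableSet (E i) := by
    intro i
    have hm : Measurable fun y => logPlus (M y) :=
      (Real.measurable_log.comp hMmeas).max measurable_const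
    exact measurableSet_Ioo.inter (measurableSet_le measurable_const hm)
  have hEfin : ∀ i, volume (E i) ≠ ⊤ := by
    intro i
    refine ((measure_mono (t := Set.Ioo (-b) b) (fun y hy => hy.1)).trans_lt ?_).ne
    simp
  have hd0 := hd z₀ hz₀
  simp only [hF] at hd0
  change ENNReal.ofReal (8 / Real.pi) * ∑' i : ℕ, volume (E i) < _ at hd0
  obtain ⟨ε, hε, hεsum⟩ := ENNReal.exists_pos_sum_of_countable (tsub_pos_of_lt hd0).ne' ℕ
  set R : ℕ → ℝ := fun i => 8 / Real.pi * (volume (E i)).toReal + ε i with hRdef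
  have hRpos : ∀ i, 0 < R i := by
    intro i
    have : (0 : ℝ) < ε i := hε i
    have h2 : 0 ≤ 8 / Real.pi * (volume (E i)).toReal := by positivity
    exact add_pos_of_nonneg_of_pos h2 this
  have hRof : ∀ i, ENNReal.ofReal (R i) = ENNReal.ofReal (8 / Real.pi) * volume (E i) + ε i := by
    intro i
    rw [hRdef]
    simp only
    rw [ENNReal.ofReal_add (by positivity) (by positivity), ENNReal.ofReal_mul (by positivity),
      ENNReal.ofReal_toReal (hEfin i), ENNReal.ofReal_coe_nnreal]
  set T := ∑' i, ENNReal.ofReal (R i) with hT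
  have hTlt : T < ENNReal.ofReal (Metric.infDist z₀ (Rect a b)ᶜ) := by
    rw [hT]
    simp only [hRof]
    rw [ENNReal.tsum_add, ENNReal.tsum_mul_left, add_comm]
    exact lt_tsub_iff_right.1 hεsum
  have hTfin : T ≠ ⊤ := (hTlt.trans_le le_top).ne
  have hTd : T.toReal < Metric.infDist z₀ (Rect a b)ᶜ :=
    (ENNReal.lt_ofReal_iff_toReal_lt hTfin).1 hTlt
  have hpartial : ∀ n, ∑ i ∈ Finset.range n, R i ≤ T.toReal := by
    intro n
    rw [← ENNReal.ofReal_le_iff_le_toReal hTfin,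
      ENNReal.ofReal_sum_of_nonneg (fun i _ => (hRpos i).le)]
    exact ENNReal.sum_le_tsum _
  have hball : Metric.closedBall z₀ T.toReal ⊆ Rect a b := by
    intro w hw
    by_contra hw'
    have h1 := Metric.infDist_le_dist_of_mem (x := z₀) (s := (Rect a b)ᶜ) hw'
    rw [Metric.mem_closedBall, dist_comm] at hw
    linarith
  have hbd' : ∀ w ∈ Rect a b, Real.log ‖f w‖ ≤ logPlus (M w.im) := by
    intro w hw
    by_cases h : f w = 0
    · rw [h]; simp [logPlus]
    · exact (Real.log_le_log (norm_pos_iff.2 h) (hbd w hw)).trans (le_max_left _ _)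
  have key : ∀ n : ℕ, ∃ w, dist w z₀ ≤ ∑ i ∈ Finset.range n, R i ∧
      (2 : ℝ) ^ n * C ≤ Real.log ‖f w‖ := by
    intro n
    induction n with
    | zero => exact ⟨z₀, by simp, by simpa using hlog0⟩
    | succ n ih =>
      obtain ⟨w, hw, hw2⟩ := ih
      have hsub : Metric.closedBall w (R n) ⊆ Rect a b := by
        intro v hv
        apply hball
        rw [Metric.mem_closedBall] at hv ⊢
        have h1 := hpartial (n + 1)
        rw [Finset.sum_range_succ] at h1
        linarith [dist_triangle v w z₀]
      obtain ⟨v, hv, hv2⟩ := step (hRpos n) (by positivity) (hE n)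
        ((hf.analyticOnNhd hopen).mono hsub) hw2 (by
          intro v hv hvE
          have hvR := hsub hv
          refine (hbd' v hvR).trans ?_
          by_contra! hcon
          apply hvE
          refine ⟨abs_lt.1 hvR.2, ?_⟩
          rw [zpow_sub₀ (by norm_num), zpow_natCast, zpow_one]
          linarith) (by
          rw [ENNReal.le_ofReal_iff_toReal_le (hEfin n) (by have := hRpos n; positivity)]
          have h1 : 8 / Real.pi * (volume (E n)).toReal ≤ R n := by
            rw [hRdef]; simp
          have h2 : Real.pi * (8 / Real.pi * (volume (E n)).toReal) ≤ Real.pi * R n :=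
            mul_le_mul_of_nonneg_left h1 hpi.le
          have h3 : Real.pi * (8 / Real.pi * (volume (E n)).toReal) =
            8 * (volume (E n)).toReal := by field_simp
          linarith)
      refine ⟨v, ?_, ?_⟩
      · rw [Finset.sum_range_succ]
        rw [Metric.mem_closedBall] at hv
        linarith [dist_triangle v w z₀]
      · rw [pow_succ]; linarith
  obtain ⟨B, hB⟩ := (isCompact_closedBall z₀ T.toReal).exists_bound_of_continuousOn
    (hf.continuousOn.mono hball)
  obtain ⟨n, hn⟩ := pow_unbounded_of_one_lt (B / C) (one_lt_two : (1 : ℝ) < 2)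
  obtain ⟨w, hw, hw2⟩ := key n
  have h1 := hB w (Metric.mem_closedBall.2 (hw.trans (hpartial n)))
  rw [div_lt_iff₀ hC] at hn
  have h2 := Real.log_le_self (norm_nonneg (f w))
  linarith
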